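/- There exist constants C ≥ 1 and 0 < k₁ ≤ k₂ (depending only on τ₁, τ₂, ρ, N₀) such that for every n ≥ C and every real x with 1 − 1/C < x < 1, k₁·(1 − x + 1/n)^{−(2ρ+1)} ≤ Σ_{i=0}^n cᵢ² x^{2i} ≤ k₂·(1 − x + 1/n)^{−(2ρ+1)}. -/

import Mathlib

open Filter Set

/-- `∑_{i=1}^m i^r = O(m^{r+1})` for `r > -1`. -/
lemma sum_Ioc_rpow_le {r : ℝ} (hr : -1 < r) (m : ℕ) :
    ∑ i ∈ Finset.Ioc 0 m, (i : ℝ) ^ r ≤ max 1 (r + 1)⁻¹ * (m : ℝ) ^ (r + 1) := by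
  have hr1 : 0 < r + 1 := by linarith
  rcases le_total 0 r with h0 | h0
  · have h1 : ∑ i ∈ Finset.Ioc 0 m, (i : ℝ) ^ r ≤ ∑ i ∈ Finset.Ioc 0 m, (m : ℝ) ^ r := by
      refine Finset.sum_le_sum fun i hi => ?_
      have := (Finset.mem_Ioc.1 hi).2
      exact Real.rpow_le_rpow (by positivity) (by exact_mod_cast this) h0
    rw [Finset.sum_const, Nat.card_Ioc, nsmul_eq_mul, Nat.sub_zero] at h1
    have h2 : (m : ℝ) * (m : ℝ) ^ r = (m : ℝ) ^ (r + 1) := by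
      rw [Real.rpow_add_one' (by positivity) hr1.ne', mul_comm]
    rw [h2] at h1
    exact h1.trans (le_mul_of_one_le_left (by positivity) (le_max_left _ _))
  · have key : ∑ i ∈ Finset.Ioc 0 m, (i : ℝ) ^ r ≤ (r + 1)⁻¹ * (m : ℝ) ^ (r + 1) := by
      induction m with
      | zero => simp [Real.zero_rpow hr1.ne']
      | succ k ih =>
        rw [Finset.sum_Ioc_succ_top (Nat.zero_le k)]
        have hk : (0 : ℝ) < ((k + 1 : ℕ) : ℝ) := by positivity
        have hb := rpow_one_add_le_one_add_mul_self (s := -(((k + 1 : ℕ) : ℝ))⁻¹)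
          (p := r + 1) (by
            have : (((k + 1 : ℕ) : ℝ))⁻¹ ≤ 1 := inv_le_one_of_one_le₀
              (by push_cast; linarith [k.cast_nonneg (α := ℝ)])
            linarith) hr1.le (by linarith)
        have hkk : (1 + -(((k + 1 : ℕ) : ℝ))⁻¹) = (k : ℝ) / ((k + 1 : ℕ) : ℝ) := by
          field_simp; push_cast; ring
        rw [hkk, Real.div_rpow (by positivity) hk.le, div_le_iff₀ (by positivity)] at hb
        have he : ((k + 1 : ℕ) : ℝ) ^ (r + 1) = ((k + 1 : ℕ) : ℝ) ^ r * ((k + 1 : ℕ) : ℝ) :=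
          Real.rpow_add_one hk.ne' r
        have hb' : (k : ℝ) ^ (r + 1) ≤
            ((k + 1 : ℕ) : ℝ) ^ (r + 1) - (r + 1) * ((k + 1 : ℕ) : ℝ) ^ r := by
          refine hb.trans_eq ?_
          rw [he]; field_simp; ring
        have := mul_le_mul_of_nonneg_left hb' (inv_nonneg.2 hr1.le)
        rw [mul_sub, inv_mul_cancel_left₀ hr1.ne'] at this
        linarith
    exact key.trans (by gcongr; exact le_max_right _ _)

/-- Beyond the scale `M = (1 - x + 1/n)⁻¹`, the powers of `x` decay faster than any power. -/
lemma pow_le_mul_rpow_neg {x M s : ℝ} {n i : ℕ} (hx : 0 ≤ x) (hM : 0 < M)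
    (hxM : 1 - x = M⁻¹ - (n : ℝ)⁻¹) (hin : i ≤ n) (hMi : M ≤ i) :
    x ^ i ≤ Real.exp 1 * (⌈s⌉₊.factorial : ℝ) * ((i : ℝ) / M) ^ (-s) := by
  have hy : 1 ≤ (i : ℝ) / M := (one_le_div hM).2 hMi
  have hy0 : 0 < (i : ℝ) / M := by positivity
  have h1 : x ^ i ≤ Real.exp 1 * Real.exp (-((i : ℝ) / M)) := by
    rw [← Real.exp_add]
    have h2 : x ≤ Real.exp (-(1 - x)) := by
      have := Real.add_one_le_exp (-(1 - x)); linarith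
    refine (pow_le_pow_left₀ hx h2 i).trans ?_
    rw [← Real.exp_nat_mul, Real.exp_le_exp, hxM]
    have h3 : (i : ℝ) * (n : ℝ)⁻¹ ≤ 1 := by
      rw [← div_eq_mul_inv]
      exact div_le_one_of_le₀ (by exact_mod_cast hin) (by positivity)
    rw [div_eq_mul_inv]; linarith
  have h4 : Real.exp (-((i : ℝ) / M)) ≤ (⌈s⌉₊.factorial : ℝ) * ((i : ℝ) / M) ^ (-s) := by
    have h5 := Real.pow_div_factorial_le_exp _ hy0.le ⌈s⌉₊
    have h6 : ((i : ℝ) / M) ^ s ≤ ((i : ℝ) / M) ^ ⌈s⌉₊ := by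
      rw [← Real.rpow_natCast]
      exact Real.rpow_le_rpow_of_exponent_le hy (Nat.le_ceil s)
    rw [Real.exp_neg, Real.rpow_neg hy0.le, ← div_eq_mul_inv,
      inv_le_comm₀ (Real.exp_pos _) (by positivity), inv_div]
    exact (div_le_div_of_nonneg_right h6 (by positivity)).trans h5
  rw [mul_assoc]
  exact h1.trans (mul_le_mul_of_nonneg_left h4 (Real.exp_pos 1).le)

/-- Lower bound for the powers of `x` below the scale `M ≤ (1 - x)⁻¹`. -/
lemma exp_neg_four_le_pow {x M : ℝ} {i : ℕ} (hx : 1 / 2 ≤ x) (hM : 0 < M)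
    (hxM : 1 - x ≤ M⁻¹) (hi : (i : ℝ) ≤ M) : Real.exp (-4) ≤ x ^ (2 * i) := by
  have hx0 : 0 < x := by linarith
  rcases le_total 1 x with h1 | h1
  · exact (Real.exp_le_one_iff.2 (by norm_num)).trans (one_le_pow₀ h1)
  have h2 : Real.exp (-(2 * (1 - x))) ≤ x := by
    rw [Real.exp_neg, inv_le_comm₀ (Real.exp_pos _) hx0]
    have h3 := Real.add_one_le_exp (2 * (1 - x))
    refine le_trans ?_ h3
    rw [inv_le_iff_one_le_mul₀ hx0]
    nlinarith
  refine le_trans ?_ (pow_le_pow_left₀ (Real.exp_pos _).le h2 _)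
  rw [← Real.exp_nat_mul, Real.exp_le_exp]
  have h4 : (i : ℝ) * (1 - x) ≤ 1 :=
    (mul_le_mul hi hxM (by linarith) hM.le).trans_eq (mul_inv_cancel₀ hM.ne')
  push_cast
  linarith

lemma rpow_abs_mul_rpow_le {r M y : ℝ} (hM : 0 < M) (h1 : M / 4 ≤ y) (h2 : y ≤ M) :
    (1 / 4 : ℝ) ^ |r| * M ^ r ≤ y ^ r := by
  have hy : 0 < y := by linarith
  have h3 : (1 / 4 : ℝ) ^ |r| ≤ (y / M) ^ r := by
    have h4 : 1 / 4 ≤ y / M := by rw [le_div_iff₀ hM]; linarith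
    have h5 : y / M ≤ 1 := (div_le_one hM).2 h2
    calc (1 / 4 : ℝ) ^ |r| ≤ (y / M) ^ |r| := Real.rpow_le_rpow (by norm_num) h4 (abs_nonneg r)
      _ ≤ (y / M) ^ r := Real.rpow_le_rpow_of_exponent_ge (by positivity) h5 (le_abs_self r)
  rwa [Real.div_rpow hy.le hM.le, le_div_iff₀ (by positivity)] at h3

/-- Lower bound for a power sum with coefficients at least `a i^r`, at scale `M`. -/
lemma mul_rpow_le_sum {a r M x : ℝ} {N n : ℕ} {b : ℕ → ℝ} (ha : 0 ≤ a)
    (hb0 : ∀ i, 0 ≤ b i) (hb : ∀ i, N ≤ i → i ≤ n → a * (i : ℝ) ^ r ≤ b i)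
    (hM : 4 ≤ M) (hMN : 4 * (N : ℝ) ≤ M) (hMn : M ≤ n) (hx : 1 / 2 ≤ x)
    (hxM : 1 - x ≤ M⁻¹) :
    a * (1 / 4 : ℝ) ^ |r| * Real.exp (-4) / 4 * M ^ (r + 1) ≤
      ∑ i ∈ Finset.range (n + 1), b i * x ^ (2 * i) := by
  have hM0 : 0 < M := by linarith
  set m := ⌊M / 2⌋₊ with hm
  have hm1 : (m : ℝ) ≤ M / 2 := Nat.floor_le (by linarith)
  have hm2 : M / 4 ≤ m := by
    have := Nat.lt_floor_add_one (M / 2); rw [← hm] at this; linarith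
  have hsub : Finset.Ioc m (2 * m) ⊆ Finset.range (n + 1) := by
    intro i hi
    have h1 := (Finset.mem_Ioc.1 hi).2
    have h2 : 2 * m ≤ n := by
      have : (2 * m : ℝ) ≤ n := by linarith
      exact_mod_cast this
    rw [Finset.mem_range]; omega
  refine le_trans ?_ (Finset.sum_le_sum_of_subset_of_nonneg hsub fun i _ _ =>
    mul_nonneg (hb0 i) (by positivity))
  have hterm : ∀ i ∈ Finset.Ioc m (2 * m),
      a * ((1 / 4 : ℝ) ^ |r| * M ^ r) * Real.exp (-4) ≤ b i * x ^ (2 * i) := by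
    intro i hi
    have hin := Finset.mem_range.1 (hsub hi)
    obtain ⟨h1, h2⟩ := Finset.mem_Ioc.1 hi
    have h1' : (m : ℝ) < i := by exact_mod_cast h1
    have h2' : (i : ℝ) ≤ 2 * m := by exact_mod_cast h2
    have hNi : N ≤ i := by
      have : (N : ℝ) ≤ i := by linarith
      exact_mod_cast this
    refine mul_le_mul ?_ (exp_neg_four_le_pow hx hM0 hxM (by linarith))
      (Real.exp_pos _).le (hb0 i)
    exact (mul_le_mul_of_nonneg_left
      (rpow_abs_mul_rpow_le hM0 (by linarith) (by linarith)) ha).trans (hb i hNi (by omega))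
  have hcard := Finset.card_nsmul_le_sum _ _ _ hterm
  rw [Nat.card_Ioc, nsmul_eq_mul, show 2 * m - m = m by omega] at hcard
  refine le_trans ?_ hcard
  rw [Real.rpow_add_one hM0.ne']
  have h0 : 0 ≤ a * ((1 / 4 : ℝ) ^ |r| * M ^ r) * Real.exp (-4) := by positivity
  have := mul_le_mul_of_nonneg_right hm2 h0
  linarith

/-- Upper bound for a power sum with coefficients at most `a i^r`, at scale `M`. -/
lemma sum_le_mul_rpow {a r M x : ℝ} {N n : ℕ} {b : ℕ → ℝ} (ha : 0 ≤ a) (hr : -1 < r)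
    (hN : 1 ≤ N) (hbs : ∀ i, i < N → b i ≤ a)
    (hb : ∀ i, N ≤ i → i ≤ n → b i ≤ a * (i : ℝ) ^ r)
    (hM : 2 ≤ M) (hMN : (N : ℝ) ≤ M) (hMn : M ≤ n) (hx0 : 0 ≤ x) (hx1 : x ≤ 1)
    (hxM : 1 - x = M⁻¹ - (n : ℝ)⁻¹) :
    ∑ i ∈ Finset.range (n + 1), b i * x ^ (2 * i) ≤
      a * (N + max 1 (r + 1)⁻¹ + 2 * (Real.exp 1 * (⌈r + 2⌉₊.factorial : ℝ))) * M ^ (r + 1) := by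
  have hM0 : 0 < M := by linarith
  set K := Real.exp 1 * (⌈r + 2⌉₊.factorial : ℝ) with hK
  have hK0 : 0 ≤ K := by positivity
  set m := ⌊M⌋₊ with hm
  have hm1 : (m : ℝ) ≤ M := Nat.floor_le hM0.le
  have hm3 : M < m + 1 := Nat.lt_floor_add_one M
  have hm2 : M / 2 ≤ m := by linarith
  have hNm : N ≤ m := Nat.le_floor hMN
  have hmn : m ≤ n := by
    have : (m : ℝ) ≤ n := by linarith
    exact_mod_cast this
  have hxp : ∀ i : ℕ, x ^ (2 * i) ≤ 1 := fun i => pow_le_one₀ hx0 hx1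
  have hA : ∑ i ∈ Finset.range N, b i * x ^ (2 * i) ≤ a * N * M ^ (r + 1) := by
    have h1 : ∑ i ∈ Finset.range N, b i * x ^ (2 * i) ≤ ∑ i ∈ Finset.range N, a := by
      refine Finset.sum_le_sum fun i hi => ?_
      calc b i * x ^ (2 * i) ≤ a * x ^ (2 * i) :=
            mul_le_mul_of_nonneg_right (hbs i (Finset.mem_range.1 hi)) (by positivity)
        _ ≤ a := mul_le_of_le_one_right ha (hxp i)
    rw [Finset.sum_const, Finset.card_range, nsmul_eq_mul, mul_comm] at h1
    exact h1.trans (le_mul_of_one_le_right (by positivity)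
      (Real.one_le_rpow (by linarith) (by linarith)))
  have hB : ∑ i ∈ Finset.Ico N (m + 1), b i * x ^ (2 * i) ≤
      a * max 1 (r + 1)⁻¹ * M ^ (r + 1) := by
    calc ∑ i ∈ Finset.Ico N (m + 1), b i * x ^ (2 * i)
        ≤ ∑ i ∈ Finset.Ico N (m + 1), a * (i : ℝ) ^ r := by
          refine Finset.sum_le_sum fun i hi => ?_
          obtain ⟨h1, h2⟩ := Finset.mem_Ico.1 hi
          refine (mul_le_mul_of_nonneg_right (hb i h1 (by omega)) (by positivity)).trans ?_
          exact mul_le_of_le_one_right (by positivity) (hxp i)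
      _ ≤ ∑ i ∈ Finset.Ioc 0 m, a * (i : ℝ) ^ r := by
          refine Finset.sum_le_sum_of_subset_of_nonneg ?_ fun i _ _ => by positivity
          intro i hi
          obtain ⟨h1, h2⟩ := Finset.mem_Ico.1 hi
          rw [Finset.mem_Ioc]; omega
      _ ≤ a * (max 1 (r + 1)⁻¹ * (m : ℝ) ^ (r + 1)) := by
          rw [← Finset.mul_sum]
          exact mul_le_mul_of_nonneg_left (sum_Ioc_rpow_le hr m) ha
      _ ≤ a * max 1 (r + 1)⁻¹ * M ^ (r + 1) := by
          rw [← mul_assoc]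
          have : (m : ℝ) ^ (r + 1) ≤ M ^ (r + 1) :=
            Real.rpow_le_rpow (by positivity) hm1 (by linarith)
          gcongr
  have hC : ∑ i ∈ Finset.Ico (m + 1) (n + 1), b i * x ^ (2 * i) ≤
      a * (2 * K) * M ^ (r + 1) := by
    calc ∑ i ∈ Finset.Ico (m + 1) (n + 1), b i * x ^ (2 * i)
        ≤ ∑ i ∈ Finset.Ico (m + 1) (n + 1), a * K * M ^ (r + 2) * ((i : ℝ) ^ 2)⁻¹ := by
          refine Finset.sum_le_sum fun i hi => ?_
          obtain ⟨h1, h2⟩ := Finset.mem_Ico.1 hi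
          have hMi : M ≤ i := by
            have : ((m + 1 : ℕ) : ℝ) ≤ i := by exact_mod_cast h1
            push_cast at this; linarith
          have hi0 : (0 : ℝ) < i := by linarith
          have hp : x ^ (2 * i) ≤ K * ((i : ℝ) / M) ^ (-(r + 2)) :=
            (pow_le_pow_of_le_one hx0 hx1 (by omega)).trans
              (pow_le_mul_rpow_neg hx0 hM0 hxM (by omega) hMi)
          calc b i * x ^ (2 * i) ≤ (a * (i : ℝ) ^ r) * (K * ((i : ℝ) / M) ^ (-(r + 2))) :=
                mul_le_mul (hb i (by omega) (by omega)) hp (by positivity) (by positivity)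
            _ = a * K * M ^ (r + 2) * ((i : ℝ) ^ 2)⁻¹ := by
                rw [Real.rpow_neg (by positivity), Real.div_rpow hi0.le hM0.le,
                  Real.rpow_add hi0, Real.rpow_two]
                have := (Real.rpow_pos_of_pos hi0 r).ne'
                field_simp
      _ ≤ a * K * M ^ (r + 2) * (m : ℝ)⁻¹ := by
          rw [← Finset.mul_sum]
          refine mul_le_mul_of_nonneg_left ?_ (by positivity)
          have h := sum_Ioc_inv_sq_le_sub (α := ℝ) (k := m) (n := n) (by omega) hmn
          have he : Finset.Ico (m + 1) (n + 1) = Finset.Ioc m n := by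
            ext i; simp only [Finset.mem_Ico, Finset.mem_Ioc]; omega
          rw [he]
          have : (0 : ℝ) ≤ (n : ℝ)⁻¹ := by positivity
          linarith
      _ ≤ a * K * M ^ (r + 2) * (M / 2)⁻¹ := by gcongr
      _ = a * (2 * K) * M ^ (r + 1) := by
          rw [show r + 2 = (r + 1) + 1 by ring, Real.rpow_add_one hM0.ne' (r + 1)]
          field_simp
  rw [← Finset.sum_range_add_sum_Ico _ (show N ≤ n + 1 by omega),
    ← Finset.sum_Ico_consecutive _ (show N ≤ m + 1 by omega) (show m + 1 ≤ n + 1 by omega)]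
  linarith

/-- Two-sided bound for `V(x) = ∑_{i=0}^n cᵢ² x^{2i}`:
`V(x) = Θ((1 − x + 1/n)^{−(2ρ+1)})` for `x ∈ (1 − 1/C, 1)`. -/
theorem stmt_19
    (τ₁ τ₂ ρ : ℝ) (N₀ : ℕ)
    (hτ₁ : 0 < τ₁) (hτ₂ : 0 < τ₂) (hρ : -(1/2 : ℝ) < ρ) (hN₀ : 1 ≤ N₀)
    (c : ℕ → ℕ → ℝ)
    -- Condition (A3)
    (hcsmall : ∀ n i, i < N₀ → |c n i| ≤ τ₂)
    (hcgrow : ∀ n i, N₀ ≤ i → i ≤ n →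
      τ₁ * (i : ℝ) ^ ρ ≤ |c n i| ∧ |c n i| ≤ τ₂ * (i : ℝ) ^ ρ) :
    ∃ C : ℝ, 1 ≤ C ∧ ∃ k₁ k₂ : ℝ, 0 < k₁ ∧ k₁ ≤ k₂ ∧
      ∀ n : ℕ, C ≤ (n : ℝ) →
      ∀ x : ℝ, 1 - 1 / C < x → x < 1 →
        k₁ * (1 - x + 1 / (n : ℝ)) ^ (-(2 * ρ + 1)) ≤
          ∑ i ∈ Finset.range (n + 1), (c n i) ^ 2 * x ^ (2 * i) ∧
        ∑ i ∈ Finset.range (n + 1), (c n i) ^ 2 * x ^ (2 * i) ≤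
          k₂ * (1 - x + 1 / (n : ℝ)) ^ (-(2 * ρ + 1)) := by
  have hN : (1 : ℝ) ≤ N₀ := by exact_mod_cast hN₀
  set k₁ := τ₁ ^ 2 * (1 / 4 : ℝ) ^ |2 * ρ| * Real.exp (-4) / 4
  set k₂ := τ₂ ^ 2 * (N₀ + max 1 (2 * ρ + 1)⁻¹ +
    2 * (Real.exp 1 * (⌈2 * ρ + 2⌉₊.factorial : ℝ)))
  refine ⟨8 * N₀, by linarith, k₁, max k₁ k₂, by positivity, le_max_left _ _, ?_⟩
  intro n hn x hx hx1
  have hn0 : (0 : ℝ) < n := by linarith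
  have hC : 1 / (8 * (N₀ : ℝ)) ≤ 1 / 8 :=
    one_div_le_one_div_of_le (by norm_num) (by linarith)
  have hnC : 1 / (n : ℝ) ≤ 1 / (8 * N₀) := one_div_le_one_div_of_le (by linarith) hn
  have hn1 : 0 < 1 / (n : ℝ) := by positivity
  set δ := 1 - x + 1 / (n : ℝ) with hδ
  have hδ0 : 0 < δ := by linarith
  have hMN : 4 * (N₀ : ℝ) ≤ δ⁻¹ := by
    rw [le_inv_comm₀ (by positivity) hδ0]
    have : (4 * (N₀ : ℝ))⁻¹ = 1 / (8 * N₀) + 1 / (8 * N₀) := by field_simp; norm_num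
    linarith
  have hMn : δ⁻¹ ≤ n := by
    rw [inv_le_comm₀ hδ0 hn0, ← one_div]; linarith
  have hxM : 1 - x = (δ⁻¹)⁻¹ - (n : ℝ)⁻¹ := by rw [inv_inv, hδ, one_div]; ring
  have hpow : δ ^ (-(2 * ρ + 1)) = (δ⁻¹) ^ (2 * ρ + 1) := by
    rw [Real.rpow_neg hδ0.le, Real.inv_rpow hδ0.le]
  have hsq : ∀ i : ℕ, ((i : ℝ) ^ ρ) ^ 2 = (i : ℝ) ^ (2 * ρ) := fun i => by
    rw [← Real.rpow_natCast, ← Real.rpow_mul (by positivity), mul_comm]; norm_num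
  rw [hpow]
  constructor
  · refine mul_rpow_le_sum (N := N₀) (b := fun i => c n i ^ 2) (by positivity)
      (fun i => by positivity) (fun i h1 h2 => ?_) (by linarith) hMN hMn (by linarith)
      (by rw [inv_inv]; linarith)
    rw [← hsq, ← mul_pow, ← sq_abs (c n i)]
    exact pow_le_pow_left₀ (by positivity) (hcgrow n i h1 h2).1 2
  · refine (sum_le_mul_rpow (N := N₀) (b := fun i => c n i ^ 2) (sq_nonneg τ₂) (by linarith) hN₀
      (fun i h => ?_) (fun i h1 h2 => ?_) (by linarith) (by linarith) hMn (by linarith) hx1.le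
      hxM).trans (mul_le_mul_of_nonneg_right (le_max_right k₁ k₂) (by positivity))
    · rw [← sq_abs (c n i)]
      exact pow_le_pow_left₀ (abs_nonneg _) (hcsmall n i h) 2
    · rw [← hsq, ← mul_pow, ← sq_abs (c n i)]
      exact pow_le_pow_left₀ (abs_nonneg _) (hcgrow n i h1 h2).2 2
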